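/- Weyl counting asymptotics for the explicit spectrum of the round sphere Sⁿ: Let n ≥ 1. For ℓ ∈ ℕ let m(ℓ) = C(ℓ+n, n) − C(ℓ+n−2, n) (binomial coefficients, with the convention C(a,b) = 0 when a < b, so m(0) = 1 and m(1) = n+1); m(ℓ) is the multiplicity of the eigenvalue ℓ(ℓ+n−1) of the Laplacian on Sⁿ. For Λ ≥ 0 define the counting function N(Λ) = Σ_{ℓ ∈ ℕ, ℓ(ℓ+n−1) ≤ Λ} m(ℓ). Then N(Λ)/Λ^{n/2} → 2/n! as Λ → ∞. -/

import Mathlib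

open Filter

theorem sum_range_sphere_multiplicity (n : ℕ) (hn : 1 ≤ n) (L : ℕ) :
    ∑ ℓ ∈ Finset.range (L + 1),
        ((Nat.choose (ℓ + n) n - Nat.choose (ℓ + n - 2) n : ℕ) : ℝ)
      = (Nat.choose (L + n) n : ℝ) + (Nat.choose (L + n - 1) n : ℝ) := by
  obtain ⟨d, rfl⟩ := Nat.exists_eq_add_of_le' hn
  induction L with
  | zero => simp [Nat.choose_eq_zero_of_lt (show d - 1 < d + 1 by omega)]
  | succ L ih =>
    rw [Finset.sum_range_succ, ih,
      Nat.cast_sub (Nat.choose_le_choose _ (Nat.sub_le _ _)),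
      show L + 1 + (d + 1) - 2 = L + (d + 1) - 1 by omega,
      show L + 1 + (d + 1) - 1 = L + (d + 1) by omega]
    ring

theorem mul_add_le_iff_le_sqrt_sub {x c Λ : ℝ} (hx : 0 ≤ x) (hc : 0 ≤ c) (hΛ : 0 ≤ Λ) :
    x * (x + 2 * c) ≤ Λ ↔ x ≤ √(Λ + c ^ 2) - c := by
  rw [le_sub_iff_add_le, Real.le_sqrt (by positivity) (by positivity)]
  constructor <;> intro h <;> linarith

theorem tendsto_sqrt_add_sub_div_sqrt (a c : ℝ) :
    Tendsto (fun Λ : ℝ => (√(Λ + a) - c) / √Λ) atTop (nhds 1) := by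
  have h : Tendsto (fun Λ : ℝ => √(1 + a / Λ) - c / √Λ) atTop (nhds 1) := by
    have h1 : Tendsto (fun Λ : ℝ => √(1 + a / Λ)) atTop (nhds √(1 + 0)) :=
      (tendsto_const_nhds.add (tendsto_const_nhds.div_atTop tendsto_id)).sqrt
    have h2 : Tendsto (fun Λ : ℝ => c / √Λ) atTop (nhds 0) :=
      tendsto_const_nhds.div_atTop Real.tendsto_sqrt_atTop
    simpa using h1.sub h2
  refine h.congr' ?_
  filter_upwards [eventually_gt_atTop 0] with Λ hΛ
  rw [sub_div, ← Real.sqrt_div' _ hΛ.le, add_div, div_self hΛ.ne']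

theorem tendsto_choose_div_rpow (n : ℕ) {u : ℝ → ℕ} (hu : Tendsto u atTop atTop)
    (hu1 : Tendsto (fun Λ : ℝ => (u Λ : ℝ) / √Λ) atTop (nhds 1)) :
    Tendsto (fun Λ : ℝ => (Nat.choose (u Λ) n : ℝ) / Λ ^ ((n : ℝ) / 2)) atTop
      (nhds (1 / (Nat.factorial n : ℝ))) := by
  have h := (isEquivalent_choose n).comp_tendsto hu
  have hpow : (fun Λ : ℝ => Λ ^ ((n : ℝ) / 2)) =ᶠ[atTop] fun Λ => √Λ ^ n := by
    filter_upwards [eventually_ge_atTop 0] with Λ hΛ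
    rw [Real.sqrt_eq_rpow, ← Real.rpow_natCast, ← Real.rpow_mul hΛ]
    ring_nf
  have hdiv := h.div (Asymptotics.IsEquivalent.refl (u := fun Λ : ℝ => Λ ^ ((n : ℝ) / 2)))
  refine hdiv.symm.tendsto_nhds ?_
  have hlim := (hu1.pow n).div_const (Nat.factorial n : ℝ)
  rw [one_pow] at hlim
  refine hlim.congr' ?_
  filter_upwards [hpow] with Λ hΛ
  simp only [Function.comp_apply, Pi.div_apply, hΛ]
  ring

theorem tendsto_floor_add_div_sqrt {r : ℝ → ℝ}
    (hr : Tendsto (fun Λ : ℝ => r Λ / √Λ) atTop (nhds 1)) (hr' : Tendsto r atTop atTop) (a : ℕ) :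
    Tendsto (fun Λ : ℝ => ((⌊r Λ⌋₊ + a : ℕ) : ℝ) / √Λ) atTop (nhds 1) := by
  have h1 := ((tendsto_nat_floor_div_atTop (R := ℝ)).comp hr').mul hr
  have h2 : Tendsto (fun Λ : ℝ => (a : ℝ) / √Λ) atTop (nhds 0) :=
    tendsto_const_nhds.div_atTop Real.tendsto_sqrt_atTop
  have h := h1.add h2
  rw [mul_one, add_zero] at h
  refine h.congr' ?_
  filter_upwards [hr'.eventually_gt_atTop 0] with Λ hΛ
  simp only [Function.comp_apply, Nat.cast_add]
  field_simp

/-- Weyl counting asymptotics for the explicit spectrum of the round sphere `Sⁿ`: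
the counting function `N(Λ) = Σ_{ℓ(ℓ+n-1) ≤ Λ} m(ℓ)` satisfies
`N(Λ)/Λ^(n/2) → 2/n!` as `Λ → ∞`, where `m(ℓ) = C(ℓ+n, n) - C(ℓ+n-2, n)`. -/
theorem weyl_counting_sphere (n : ℕ) (hn : 1 ≤ n) :
    Tendsto
      (fun Λ : ℝ =>
        (∑' ℓ : ℕ, if ((ℓ * (ℓ + n - 1) : ℕ) : ℝ) ≤ Λ
            then ((Nat.choose (ℓ + n) n - Nat.choose (ℓ + n - 2) n : ℕ) : ℝ) else 0)
          / Λ ^ ((n : ℝ) / 2))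
      atTop (nhds (2 / (Nat.factorial n : ℝ))) := by
  set c : ℝ := ((n : ℝ) - 1) / 2 with hc_def
  have hn' : (1 : ℝ) ≤ n := by exact_mod_cast hn
  have hc : 0 ≤ c := by linarith
  set r : ℝ → ℝ := fun Λ => √(Λ + c ^ 2) - c with hr_def
  have hr : Tendsto r atTop atTop :=
    tendsto_atTop_add_const_right _ (-c)
      (Real.tendsto_sqrt_atTop.comp (tendsto_atTop_add_const_right _ (c ^ 2) tendsto_id))
  have hr1 : Tendsto (fun Λ => r Λ / √Λ) atTop (nhds 1) := tendsto_sqrt_add_sub_div_sqrt _ _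
  have hfloor (a : ℕ) : Tendsto (fun Λ => ⌊r Λ⌋₊ + a) atTop atTop :=
    (tendsto_add_atTop_nat a).comp (tendsto_nat_floor_atTop.comp hr)
  have hchoose (a : ℕ) := tendsto_choose_div_rpow n (hfloor a) (tendsto_floor_add_div_sqrt hr1 hr a)
  have hsum := (hchoose n).add (hchoose (n - 1))
  rw [← add_div, one_add_one_eq_two] at hsum
  refine hsum.congr' ?_
  filter_upwards [hr.eventually_ge_atTop 0, eventually_ge_atTop 0] with Λ hrΛ hΛ
  have hmem (ℓ : ℕ) : ((ℓ * (ℓ + n - 1) : ℕ) : ℝ) ≤ Λ ↔ ℓ ∈ Finset.range (⌊r Λ⌋₊ + 1) := by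
    rw [Finset.mem_range, Nat.lt_succ_iff, Nat.le_floor_iff hrΛ,
      ← mul_add_le_iff_le_sqrt_sub ℓ.cast_nonneg hc hΛ, Nat.cast_mul, Nat.cast_sub (by omega), hc_def]
    push_cast
    ring_nf
  rw [tsum_eq_sum (s := Finset.range (⌊r Λ⌋₊ + 1))
      (fun ℓ hℓ => if_neg (mt (hmem ℓ).1 hℓ)),
    Finset.sum_congr rfl (fun ℓ hℓ => if_pos ((hmem ℓ).2 hℓ)),
    sum_range_sphere_multiplicity n hn, add_div, Nat.add_sub_assoc hn]
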